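/- Let G be a disconnected graph of order n ≥ 6 and let 2 ≤ s ≤ n−3. Then G ∈ 𝒢^s(n) (i.e., G has exactly two positive eigenvalues and exactly s zero eigenvalues) if and only if either G ≅ H + K_1 for some H ∈ 𝒢^{s−1}(n−1), or G ≅ K_{t_1,…,t_p} + K_{r_1,…,r_q} is the disjoint union of two complete multipartite graphs each with at least two parts, where [(t_1−1)+⋯+(t_p−1)] + [(r_1−1)+⋯+(r_q−1)] = s and t_1+⋯+t_p+r_1+⋯+r_q = n. -/

import Mathlib

open Matrix BigOperators

namespace TwoPosEig

variable {V : Type*}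

/-- The real adjacency matrix of a simple graph (classical decidability). -/
noncomputable def adjMat [Fintype V] [DecidableEq V] (G : SimpleGraph V) : Matrix V V ℝ :=
  letI := Classical.decRel G.Adj
  G.adjMatrix ℝ

lemma adjMat_isHermitian [Fintype V] [DecidableEq V] (G : SimpleGraph V) :
    (adjMat G).IsHermitian := by
  letI := Classical.decRel G.Adj
  rw [Matrix.IsHermitian, Matrix.conjTranspose_eq_transpose_of_trivial]
  exact SimpleGraph.isSymm_adjMatrix G

/-- The eigenvalues of (the adjacency matrix of) a graph, as a function on vertices. -/
noncomputable def eigs [Fintype V] [DecidableEq V] (G : SimpleGraph V) : V → ℝ :=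
  (adjMat_isHermitian G).eigenvalues

/-- `p(G)`: the number of positive eigenvalues (with multiplicity). -/
noncomputable def posCount [Finite V] (G : SimpleGraph V) : ℕ :=
  letI := Fintype.ofFinite V
  letI := Classical.decEq V
  Nat.card {i : V // 0 < eigs G i}

/-- `η(G)`: the number of zero eigenvalues (with multiplicity), the nullity. -/
noncomputable def nullCount [Finite V] (G : SimpleGraph V) : ℕ :=
  letI := Fintype.ofFinite V
  letI := Classical.decEq V
  Nat.card {i : V // eigs G i = 0}

/-- `λ_k(G)`: the `k`-th largest eigenvalue (1-indexed); junk value `0` out of range. -/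
noncomputable def lam [Finite V] (G : SimpleGraph V) (k : ℕ) : ℝ :=
  letI := Fintype.ofFinite V
  letI := Classical.decEq V
  (((Finset.univ.val.map (eigs G)).sort (· ≤ ·)).reverse).getD (k - 1) 0

/-- Membership in `𝒢^s(n)` (the order `n` being the cardinality of the vertex type):
`p(G) = 2` and `η(G) = s`. -/
def memClass [Finite V] (s : ℕ) (G : SimpleGraph V) : Prop :=
  posCount G = 2 ∧ nullCount G = s

/-- `v` is a congruent vertex of I-type: some other vertex `u`, non-adjacent to `v`,
has the same neighbourhood. -/
def ITypeVertex (G : SimpleGraph V) (v : V) : Prop :=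
  ∃ u, u ≠ v ∧ ¬ G.Adj u v ∧ G.neighborSet u = G.neighborSet v

/-- `u` is a congruent vertex of II-type: there are two non-adjacent vertices `v, w`
such that `N(u)` is a disjoint union of `N(v)` and `N(w)`. -/
def IITypeVertex (G : SimpleGraph V) (u : V) : Prop :=
  ∃ v w, v ≠ w ∧ ¬ G.Adj v w ∧ Disjoint (G.neighborSet v) (G.neighborSet w) ∧
    G.neighborSet u = G.neighborSet v ∪ G.neighborSet w

/-- `u v x y` is a congruent (induced) quadrangle with congruent edges `uv`, `xy`. -/
def CongruentQuad (G : SimpleGraph V) (u v x y : V) : Prop :=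
  u ≠ v ∧ u ≠ x ∧ u ≠ y ∧ v ≠ x ∧ v ≠ y ∧ x ≠ y ∧
  G.Adj u v ∧ G.Adj v x ∧ G.Adj x y ∧ G.Adj y u ∧ ¬ G.Adj u x ∧ ¬ G.Adj v y ∧
  G.neighborSet u \ {y, v} = G.neighborSet v \ {u, x} ∧
  G.neighborSet x \ {v, y} = G.neighborSet y \ {x, u}

/-- A congruent vertex of III-type: a vertex of some congruent quadrangle. -/
def IIITypeVertex (G : SimpleGraph V) (z : V) : Prop :=
  ∃ u v x y, CongruentQuad G u v x y ∧ (z = u ∨ z = v ∨ z = x ∨ z = y)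

/-- Membership in `𝒢_1^s(n)`: a connected graph obtained by adding a congruent vertex
of I-type to some graph in `𝒢^{s-1}(n-1)`. -/
def memG1 {n : ℕ} (s : ℕ) (G : SimpleGraph (Fin n)) : Prop :=
  G.Connected ∧ ∃ v : Fin n, ITypeVertex G v ∧ memClass (s - 1) (G.induce {v}ᶜ)

/-- Membership in `𝒢_2^s(n)`. -/
def memG2 {n : ℕ} (s : ℕ) (G : SimpleGraph (Fin n)) : Prop :=
  G.Connected ∧ ∃ v : Fin n, IITypeVertex G v ∧ memClass (s - 1) (G.induce {v}ᶜ)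

/-- Membership in `𝒢_3^s(n)`. -/
def memG3 {n : ℕ} (s : ℕ) (G : SimpleGraph (Fin n)) : Prop :=
  G.Connected ∧ ∃ v : Fin n, IIITypeVertex G v ∧ memClass (s - 1) (G.induce {v}ᶜ)

/-- Oboudi's graph `G_m`: two cliques `K_{⌈m/2⌉}` (on `v_1, …`) and `K_{⌊m/2⌋}`
(on `w_1, …`), where `v_i ∼ w_j` iff `j ≥ ⌊m/2⌋ - i + 2` (1-indexed), i.e. (0-indexed)
`⌊m/2⌋ ≤ i + j`. -/
def oboudi (m : ℕ) : SimpleGraph (Fin ((m + 1) / 2) ⊕ Fin (m / 2)) :=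
  SimpleGraph.fromRel fun a b =>
    match a, b with
    | Sum.inl _, Sum.inl _ => True
    | Sum.inr _, Sum.inr _ => True
    | Sum.inl i, Sum.inr j => m / 2 ≤ (i : ℕ) + (j : ℕ)
    | Sum.inr _, Sum.inl _ => False

/-- The generalized lexicographic product `G[K_{t v}]`: each vertex `v` is replaced by a
clique of order `t v`, with complete joins along edges of `G`. -/
def lexProd (G : SimpleGraph V) (t : V → ℕ) : SimpleGraph (Σ v : V, Fin (t v)) :=
  SimpleGraph.fromRel fun a b => a.1 = b.1 ∨ G.Adj a.1 b.1

/-- Index conversion identifying the vertices `v_1, …, v_{⌈k/2⌉}, w_1, …, w_{⌊k/2⌋}`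
of `G_k` with `Fin k` (in this order). -/
def toIdx {k : ℕ} : Fin ((k + 1) / 2) ⊕ Fin (k / 2) → Fin k
  | Sum.inl i => ⟨(i : ℕ), by have := i.isLt; omega⟩
  | Sum.inr j => ⟨(k + 1) / 2 + (j : ℕ), by have := j.isLt; omega⟩

/-- `B_k(n_1, …, n_k) = G_k[K_{n_1}, …, K_{n_k}]`. -/
def bGraph (k : ℕ) (nn : Fin k → ℕ) :
    SimpleGraph (Σ v : Fin ((k + 1) / 2) ⊕ Fin (k / 2), Fin (nn (toIdx v))) :=
  lexProd (oboudi k) fun v => nn (toIdx v)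

/-- Membership in `𝓓* = {B_k(n_1,…,n_k) ∈ 𝓑_k^{00}(n) : 4 ≤ k ≤ 14, n ≤ 14}` (up to
isomorphism). -/
def memDstar {n : ℕ} (G : SimpleGraph (Fin n)) : Prop :=
  ∃ (k : ℕ) (nn : Fin k → ℕ), 4 ≤ k ∧ k ≤ 14 ∧ (∀ i, 1 ≤ nn i) ∧ (∑ i, nn i) ≤ 14 ∧
    lam (bGraph k nn) 3 = 0 ∧ lam (bGraph k nn) 4 = 0 ∧ Nonempty (G ≃g bGraph k nn)

/-- The degree of a vertex. -/
noncomputable def deg [Finite V] (G : SimpleGraph V) (v : V) : ℕ :=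
  Nat.card (G.neighborSet v)

/-- `v` is a vertex of minimum degree. -/
def IsMinDegVertex [Finite V] (G : SimpleGraph V) (v : V) : Prop :=
  ∀ w, deg G v ≤ deg G w

/-- The set `Y = V(G) ∖ N[v]`. -/
def Yset (G : SimpleGraph V) (v : V) : Set V :=
  (G.neighborSet v ∪ {v})ᶜ

/-- `G` is `X`-complete with respect to `v`: `G[Y] ≅ K_{n-t-1}` with `n-t-1 ≥ 2`
and `G[X]` is complete, where `X = N(v)`, `Y = V(G) ∖ N[v]`. -/
def IsXComplete [Finite V] (G : SimpleGraph V) (v : V) : Prop :=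
  2 ≤ (Yset G v).ncard ∧ (Yset G v).Pairwise G.Adj ∧ (G.neighborSet v).Pairwise G.Adj

/-- An `X`-complete graph is reduced when the traces on `Y` of the neighbourhoods of
vertices of `X` form a chain. -/
def IsReduced (G : SimpleGraph V) (v : V) : Prop :=
  ∀ x ∈ G.neighborSet v, ∀ x' ∈ G.neighborSet v,
    G.neighborSet x ∩ Yset G v ⊆ G.neighborSet x' ∩ Yset G v ∨
    G.neighborSet x' ∩ Yset G v ⊆ G.neighborSet x ∩ Yset G v

lemma posCount_eq [Fintype V] [DecidableEq V] (G : SimpleGraph V) :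
    posCount G = Nat.card {i : V // 0 < eigs G i} := by
  change Nat.card {i : V // 0 < @eigs V (Fintype.ofFinite V) (Classical.decEq V) G i} = _
  have h1 : Fintype.ofFinite V = ‹Fintype V› := Subsingleton.elim _ _
  have h2 : Classical.decEq V = ‹DecidableEq V› := Subsingleton.elim _ _
  rw [h1, h2]

lemma nullCount_eq [Fintype V] [DecidableEq V] (G : SimpleGraph V) :
    nullCount G = Nat.card {i : V // eigs G i = 0} := by
  change Nat.card {i : V // @eigs V (Fintype.ofFinite V) (Classical.decEq V) G i = 0} = _
  have h1 : Fintype.ofFinite V = ‹Fintype V› := Subsingleton.elim _ _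
  have h2 : Classical.decEq V = ‹DecidableEq V› := Subsingleton.elim _ _
  rw [h1, h2]

lemma card_eigs_eq [Fintype V] [DecidableEq V] (G : SimpleGraph V) (P : ℝ → Prop)
    [DecidablePred P] :
    Nat.card {i : V // P (eigs G i)} = ((adjMat G).charpoly.roots).countP P := by
  rw [(adjMat_isHermitian G).roots_charpoly_eq_eigenvalues, Multiset.countP_map,
    Nat.card_eq_fintype_card, Fintype.card_subtype]
  rfl

lemma posCount_roots [Fintype V] [DecidableEq V] (G : SimpleGraph V) :
    posCount G = ((adjMat G).charpoly.roots).countP (fun x => 0 < x) := by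
  rw [posCount_eq, card_eigs_eq G (fun x => 0 < x)]

lemma nullCount_roots [Fintype V] [DecidableEq V] (G : SimpleGraph V) :
    nullCount G = ((adjMat G).charpoly.roots).countP (fun x => x = 0) := by
  rw [nullCount_eq, card_eigs_eq G (fun x => x = 0)]

lemma adjMat_apply [Fintype V] [DecidableEq V] (G : SimpleGraph V) [DecidableRel G.Adj] (u v : V) :
    adjMat G u v = if G.Adj u v then 1 else 0 := by
  unfold adjMat
  simp only [SimpleGraph.adjMatrix_apply]
  congr

lemma charpoly_iso {W : Type*} [Fintype V] [DecidableEq V] [Fintype W] [DecidableEq W]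
    {G : SimpleGraph V} {H : SimpleGraph W} (e : G ≃g H) :
    (adjMat G).charpoly = (adjMat H).charpoly := by
  classical
  rw [← Matrix.charpoly_reindex e.toEquiv (adjMat G)]
  congr 1
  ext i j
  simp only [Matrix.reindex_apply, Matrix.submatrix_apply, adjMat_apply]
  congr 1
  rw [← e.map_adj_iff]
  change H.Adj (e (e.symm i)) (e (e.symm j)) = H.Adj i j
  rw [e.apply_symm_apply, e.apply_symm_apply]

lemma posCount_iso {W : Type*} [Finite V] [Finite W]
    {G : SimpleGraph V} {H : SimpleGraph W} (e : G ≃g H) : posCount G = posCount H := by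
  classical
  have := Fintype.ofFinite V
  have := Fintype.ofFinite W
  rw [posCount_roots, posCount_roots, charpoly_iso e]

lemma nullCount_iso {W : Type*} [Finite V] [Finite W]
    {G : SimpleGraph V} {H : SimpleGraph W} (e : G ≃g H) : nullCount G = nullCount H := by
  classical
  have := Fintype.ofFinite V
  have := Fintype.ofFinite W
  rw [nullCount_roots, nullCount_roots, charpoly_iso e]

lemma charpoly_sum {W : Type*} [Fintype V] [DecidableEq V] [Fintype W] [DecidableEq W]
    (G : SimpleGraph V) (H : SimpleGraph W) :
    (adjMat (G ⊕g H)).charpoly = (adjMat G).charpoly * (adjMat H).charpoly := by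
  classical
  rw [← Matrix.charpoly_fromBlocks_zero₁₂ (M₂₁ := 0)]
  congr 1
  ext i j
  rcases i with i | i <;> rcases j with j | j <;> simp [adjMat_apply]

lemma posCount_sum {W : Type*} [Finite V] [Finite W]
    (G : SimpleGraph V) (H : SimpleGraph W) :
    posCount (G ⊕g H) = posCount G + posCount H := by
  classical
  have := Fintype.ofFinite V
  have := Fintype.ofFinite W
  rw [posCount_roots, posCount_roots, posCount_roots, charpoly_sum, Polynomial.roots_mul,
    Multiset.countP_add]
  exact mul_ne_zero (Matrix.charpoly_monic _).ne_zero (Matrix.charpoly_monic _).ne_zero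

lemma nullCount_sum {W : Type*} [Finite V] [Finite W]
    (G : SimpleGraph V) (H : SimpleGraph W) :
    nullCount (G ⊕g H) = nullCount G + nullCount H := by
  classical
  have := Fintype.ofFinite V
  have := Fintype.ofFinite W
  rw [nullCount_roots, nullCount_roots, nullCount_roots, charpoly_sum, Polynomial.roots_mul,
    Multiset.countP_add]
  exact mul_ne_zero (Matrix.charpoly_monic _).ne_zero (Matrix.charpoly_monic _).ne_zero

lemma charpoly_bot_one : (adjMat (⊥ : SimpleGraph (Fin 1))).charpoly = Polynomial.X := by
  have : adjMat (⊥ : SimpleGraph (Fin 1)) = 0 := by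
    ext i j
    classical
    rw [adjMat_apply]; simp
  rw [this]
  simp [Matrix.charpoly, Matrix.charmatrix]

lemma posCount_bot_one : posCount (⊥ : SimpleGraph (Fin 1)) = 0 := by
  rw [posCount_roots, charpoly_bot_one, Polynomial.roots_X, ← Multiset.cons_zero,
    Multiset.countP_cons]; simp

lemma nullCount_bot_one : nullCount (⊥ : SimpleGraph (Fin 1)) = 1 := by
  rw [nullCount_roots, charpoly_bot_one, Polynomial.roots_X, ← Multiset.cons_zero,
    Multiset.countP_cons]; simp

/-- The spectral expansion of the quadratic form. -/
lemma form_eq [Fintype V] [DecidableEq V] (G : SimpleGraph V) (x : V → ℝ) :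
    x ⬝ᵥ (adjMat G *ᵥ x) = ∑ i, eigs G i *
      (x ⬝ᵥ ((adjMat_isHermitian G).eigenvectorBasis i : V → ℝ)) ^ 2 := by
  set hA := adjMat_isHermitian G
  set b := hA.eigenvectorBasis
  have key := b.sum_inner_mul_inner (WithLp.toLp 2 x) (WithLp.toLp 2 (adjMat G *ᵥ x))
  have h1 : ∀ y z : V → ℝ, inner ℝ (WithLp.toLp 2 y) (WithLp.toLp 2 z) = y ⬝ᵥ z := by
    intro y z
    simp [EuclideanSpace.inner_eq_star_dotProduct, dotProduct_comm]
  rw [h1] at key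
  rw [← key]
  refine Finset.sum_congr rfl fun i _ => ?_
  have h2 := h1 x (b i)
  have h3 := h1 (b i) (adjMat G *ᵥ x)
  simp only [WithLp.toLp_ofLp] at h2 h3
  rw [h2, h3]
  have h4 : (b i : V → ℝ) ⬝ᵥ (adjMat G *ᵥ x) = eigs G i * (x ⬝ᵥ (b i : V → ℝ)) := by
    have hT : (adjMat G)ᵀ = adjMat G := by
      have := hA; rwa [Matrix.IsHermitian, Matrix.conjTranspose_eq_transpose_of_trivial] at this
    rw [Matrix.dotProduct_mulVec, ← Matrix.mulVec_transpose, hT, hA.mulVec_eigenvectorBasis,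
      smul_dotProduct, dotProduct_comm, smul_eq_mul]
    rfl
  rw [h4]; ring

lemma form_basis [Fintype V] [DecidableEq V] (G : SimpleGraph V) (i j : V) :
    ((adjMat_isHermitian G).eigenvectorBasis i : V → ℝ) ⬝ᵥ
      ((adjMat_isHermitian G).eigenvectorBasis j : V → ℝ) = if i = j then 1 else 0 := by
  have := orthonormal_iff_ite.1 (adjMat_isHermitian G).eigenvectorBasis.orthonormal i j
  rw [← this]
  simp [EuclideanSpace.inner_eq_star_dotProduct, dotProduct_comm]

lemma posCount_pos [Finite V] (G : SimpleGraph V) {u v : V} (h : G.Adj u v) :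
    1 ≤ posCount G := by
  classical
  have := Fintype.ofFinite V
  rw [posCount_eq, Nat.one_le_iff_ne_zero, Nat.card_ne_zero]
  refine ⟨?_, inferInstance⟩
  by_contra hne
  have hle : ∀ i, eigs G i ≤ 0 := fun i => not_lt.1 fun hi => hne ⟨⟨i, hi⟩⟩
  have := form_eq G (Pi.single u 1 + Pi.single v 1)
  have h2 : ∑ i, eigs G i * ((Pi.single u 1 + Pi.single v 1) ⬝ᵥ
      ((adjMat_isHermitian G).eigenvectorBasis i : V → ℝ)) ^ 2 ≤ 0 :=
    Finset.sum_nonpos fun i _ => mul_nonpos_of_nonpos_of_nonneg (hle i) (sq_nonneg _)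
  rw [← this] at h2
  simp [Matrix.mulVec_add, adjMat_apply, h, h.symm] at h2
  norm_num at h2

lemma exists_functional [Fintype V] [DecidableEq V] (G : SimpleGraph V) (h : posCount G ≤ 1) :
    ∃ c : V → ℝ, ∀ x : V → ℝ, x ⬝ᵥ c = 0 → x ⬝ᵥ (adjMat G *ᵥ x) ≤ 0 := by
  rw [posCount_eq, Finite.card_le_one_iff_subsingleton] at h
  by_cases hne : ∃ i, 0 < eigs G i
  · obtain ⟨i, hi⟩ := hne
    refine ⟨(adjMat_isHermitian G).eigenvectorBasis i, fun x hx => ?_⟩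
    rw [form_eq]
    refine Finset.sum_nonpos fun j _ => ?_
    by_cases hj : 0 < eigs G j
    · have : (⟨j, hj⟩ : {i // 0 < eigs G i}) = ⟨i, hi⟩ := Subsingleton.elim _ _
      have hji : j = i := congrArg Subtype.val this
      rw [hji, hx]; simp
    · exact mul_nonpos_of_nonpos_of_nonneg (not_lt.1 hj) (sq_nonneg _)
  · push Not at hne
    refine ⟨0, fun x _ => ?_⟩
    rw [form_eq]
    exact Finset.sum_nonpos fun j _ => mul_nonpos_of_nonpos_of_nonneg (hne j) (sq_nonneg _)

lemma exists_comb (a b : ℝ) : ∃ α β : ℝ, (α ≠ 0 ∨ β ≠ 0) ∧ α * a + β * b = 0 := by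
  by_cases h : a = 0
  · exact ⟨1, 0, by simp, by simp [h]⟩
  · exact ⟨b, -a, Or.inr (neg_ne_zero.2 h), by ring⟩

lemma posCount_le_one [Fintype V] [DecidableEq V] (G : SimpleGraph V) (c : V → ℝ)
    (hc : ∀ x : V → ℝ, x ⬝ᵥ c = 0 → x ⬝ᵥ (adjMat G *ᵥ x) ≤ 0) : posCount G ≤ 1 := by
  rw [posCount_eq, Finite.card_le_one_iff_subsingleton]
  refine ⟨fun ⟨i, hi⟩ ⟨j, hj⟩ => ?_⟩
  by_contra hij
  have hij : i ≠ j := fun h => hij (Subtype.ext h)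
  set b : V → V → ℝ := fun k => ((adjMat_isHermitian G).eigenvectorBasis k : V → ℝ) with hb
  obtain ⟨α, β, hne, h0⟩ := exists_comb (b i ⬝ᵥ c) (b j ⬝ᵥ c)
  have h1 := hc (α • b i + β • b j) (by simpa [add_dotProduct, smul_dotProduct] using h0)
  rw [form_eq] at h1
  have h2 : ∀ k, (α • b i + β • b j) ⬝ᵥ ((adjMat_isHermitian G).eigenvectorBasis k : V → ℝ) =
      α * (if i = k then 1 else 0) + β * (if j = k then 1 else 0) := by
    intro k
    rw [add_dotProduct, smul_dotProduct, smul_dotProduct, form_basis, form_basis]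
    simp
  simp only [h2] at h1
  have h3 : ∀ k, eigs G k * (α * (if i = k then 1 else 0) + β * (if j = k then 1 else 0)) ^ 2 =
      (if i = k then eigs G k * α ^ 2 else 0) + (if j = k then eigs G k * β ^ 2 else 0) := by
    intro k
    by_cases h : i = k
    · have : j ≠ k := fun h' => hij (h.trans h'.symm)
      simp [h, this]
    · simp [h]
  simp only [h3, Finset.sum_add_distrib, Finset.sum_ite_eq, Finset.mem_univ, if_true] at h1
  rcases hne with h | h
  · have := mul_pos hi (pow_pos (abs_pos.2 h) 2)
    rw [sq_abs] at this
    nlinarith [mul_nonneg hj.le (sq_nonneg β)]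
  · have := mul_pos hj (pow_pos (abs_pos.2 h) 2)
    rw [sq_abs] at this
    nlinarith [mul_nonneg hi.le (sq_nonneg α)]

lemma isCompleteMultipartite_of [Finite V] (G : SimpleGraph V) (h : posCount G ≤ 1)
    (hiso : ∀ v, ∃ w, G.Adj v w) : G.IsCompleteMultipartite := by
  classical
  have := Fintype.ofFinite V
  refine ⟨fun u v w huv hvw huw => ?_⟩
  obtain ⟨x, hx⟩ := hiso v
  obtain ⟨c, hc⟩ := exists_functional G h
  obtain ⟨α, β, hne, h0⟩ := exists_comb (c u + c w) (c x + 2 * c v)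
  have h1 := hc (α • (Pi.single u 1 + Pi.single w 1) + β • (Pi.single x 1 + (2:ℝ) • Pi.single v 1))
    (by simp [add_dotProduct, smul_dotProduct]; linarith)
  have hvu : ¬ G.Adj v u := fun h => huv h.symm
  have hwv : ¬ G.Adj w v := fun h => hvw h.symm
  simp [Matrix.mulVec_add, Matrix.mulVec_smul, adjMat_apply, huw, huw.symm, hx, hx.symm,
    huv, hvw, hvu, hwv] at h1
  rw [G.adj_comm u x, G.adj_comm w x] at h1
  have hpos : 0 < α ^ 2 + β ^ 2 := by
    rcases hne with h | h
    · positivity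
    · positivity
  split_ifs at h1 <;> nlinarith [sq_nonneg (α + β), sq_nonneg (α + 2 * β), sq_nonneg (2*α+3*β), sq_nonneg α, sq_nonneg β]

lemma adj_mulVec_of_color {p : ℕ} [Fintype V] [DecidableEq V] (G : SimpleGraph V) (c : V → Fin p)
    (hG : ∀ x y, G.Adj x y ↔ c x ≠ c y) (x : V → ℝ) (v : V) :
    (adjMat G *ᵥ x) v = (∑ w, x w) - ∑ w, if c w = c v then x w else 0 := by
  classical
  rw [← Finset.sum_sub_distrib]
  refine Finset.sum_congr rfl fun w _ => ?_
  change adjMat G v w * x w = _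
  rw [adjMat_apply]
  simp only [hG]
  by_cases h : c v = c w
  · simp [h]
  · simp [h, Ne.symm h]

lemma sum_color {p : ℕ} [Fintype V] (c : V → Fin p) (x : V → ℝ) (f : Fin p → ℝ) :
    ∑ v, x v * f (c v) = ∑ j, (∑ w, if c w = j then x w else 0) * f j := by
  simp only [Finset.sum_mul]
  rw [Finset.sum_comm]
  refine Finset.sum_congr rfl fun v _ => ?_
  simp [ite_mul]

lemma posCount_of_color {p : ℕ} [Finite V] (G : SimpleGraph V) (c : V → Fin p)
    (hG : ∀ x y, G.Adj x y ↔ c x ≠ c y) (hc : Function.Surjective c) (hp : 2 ≤ p) :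
    posCount G = 1 := by
  classical
  have := Fintype.ofFinite V
  apply le_antisymm
  · apply posCount_le_one G 1
    intro x hx
    have hS : ∑ w, x w = 0 := by simpa [dotProduct] using hx
    have : x ⬝ᵥ (adjMat G *ᵥ x) = ∑ v, x v *
        (fun j => - ∑ w, if c w = j then x w else 0) (c v) := by
      refine Finset.sum_congr rfl fun v _ => ?_
      rw [adj_mulVec_of_color G c hG, hS]; simp
    rw [this, sum_color c x (fun j => - ∑ w, if c w = j then x w else 0)]
    refine Finset.sum_nonpos fun j _ => ?_
    nlinarith [sq_nonneg (∑ w, if c w = j then x w else 0)]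
  · obtain ⟨u, hu⟩ := hc ⟨0, by omega⟩
    obtain ⟨v, hv⟩ := hc ⟨1, by omega⟩
    refine posCount_pos G (u := u) (v := v) ?_
    rw [hG, hu, hv]; simp

lemma nullCount_eq_finrank [Fintype V] [DecidableEq V] (G : SimpleGraph V) :
    nullCount G = Module.finrank ℝ (LinearMap.ker (adjMat G).mulVecLin) := by
  have h1 := (adjMat_isHermitian G).rank_eq_card_non_zero_eigs
  have h2 := LinearMap.finrank_range_add_finrank_ker (adjMat G).mulVecLin
  rw [← Matrix.rank, h1, Module.finrank_fintype_fun_eq_card] at h2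
  have h3 := Fintype.card_subtype_compl (fun i => eigs G i = 0)
  have h4 := Fintype.card_subtype_le (fun i => eigs G i = 0)
  rw [nullCount_eq, Nat.card_eq_fintype_card]
  change Fintype.card {i // eigs G i ≠ 0} + _ = _ at h2
  change Fintype.card {i // eigs G i ≠ 0} = _ at h3
  omega

lemma nullCount_of_color {p : ℕ} [Finite V] (G : SimpleGraph V) (c : V → Fin p)
    (hG : ∀ x y, G.Adj x y ↔ c x ≠ c y) (hc : Function.Surjective c) (hp : 2 ≤ p) :
    nullCount G + p = Nat.card V := by
  classical
  have := Fintype.ofFinite V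
  let L : (V → ℝ) →ₗ[ℝ] (Fin p → ℝ) :=
    { toFun := fun x j => ∑ w, if c w = j then x w else 0
      map_add' := by
        intro x y; ext j
        simp only [Pi.add_apply, ← Finset.sum_add_distrib]
        refine Finset.sum_congr rfl fun w _ => ?_
        split_ifs <;> simp
      map_smul' := by
        intro a x; ext j
        simp [Finset.mul_sum] }
  have hL : ∀ x j, L x j = ∑ w, if c w = j then x w else 0 := fun _ _ => rfl
  have hker : LinearMap.ker (adjMat G).mulVecLin = LinearMap.ker L := by
    ext x
    simp only [LinearMap.mem_ker, Matrix.mulVecLin_apply]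
    have hsum : ∑ w, x w = ∑ j, L x j := by
      have := sum_color c x (fun _ => 1)
      simp only [mul_one] at this
      exact this
    constructor
    · intro h
      have hj : ∀ j, L x j = ∑ w, x w := by
        intro j
        obtain ⟨v, rfl⟩ := hc j
        have := congrFun h v
        rw [adj_mulVec_of_color G c hG, ← hL] at this
        simp only [Pi.zero_apply] at this
        linarith
      have h2 : ∑ w, x w = p * ∑ w, x w := by
        conv_lhs => rw [hsum]
        simp [hj]
      have hp' : (2:ℝ) ≤ p := by exact_mod_cast hp
      have h0 : ∑ w, x w = 0 := by
        have : ((p:ℝ) - 1) * ∑ w, x w = 0 := by linarith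
        rcases mul_eq_zero.1 this with h | h
        · linarith
        · exact h
      ext j
      rw [hj, h0]; rfl
    · intro h
      ext v
      rw [adj_mulVec_of_color G c hG, ← hL, hsum, h]
      simp
  have hsurj : Function.Surjective L := by
    intro f
    choose g hg using hc
    refine ⟨fun v => if v = g (c v) then f (c v) else 0, ?_⟩
    ext j
    rw [hL, Finset.sum_eq_single (g j)]
    · simp [hg]
    · intro w _ hw
      split_ifs with h1 h2
      · exact absurd (h2.trans (by rw [h1])) hw
      · rfl
      · rfl
    · simp
  have h1 := LinearMap.finrank_range_add_finrank_ker L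
  rw [LinearMap.range_eq_top.2 hsurj, finrank_top, Module.finrank_fintype_fun_eq_card,
    Module.finrank_fintype_fun_eq_card, Fintype.card_fin, ← hker, ← nullCount_eq_finrank] at h1
  rw [Nat.card_eq_fintype_card]
  omega

lemma counts_cmg {p : ℕ} (t : Fin p → ℕ) (hp : 2 ≤ p) (ht : ∀ i, 1 ≤ t i) :
    posCount (SimpleGraph.completeMultipartiteGraph fun i => Fin (t i)) = 1 ∧
    nullCount (SimpleGraph.completeMultipartiteGraph fun i => Fin (t i)) = ∑ i, (t i - 1) := by
  have hG : ∀ x y, (SimpleGraph.completeMultipartiteGraph fun i => Fin (t i)).Adj x y ↔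
      x.1 ≠ y.1 := by
    intro x y; simp
  have hs : Function.Surjective (Sigma.fst : (Σ i, Fin (t i)) → Fin p) :=
    fun i => ⟨⟨i, ⟨0, ht i⟩⟩, rfl⟩
  refine ⟨posCount_of_color _ _ hG hs hp, ?_⟩
  have := nullCount_of_color _ _ hG hs hp
  rw [Nat.card_eq_fintype_card, Fintype.card_sigma] at this
  simp only [Fintype.card_fin] at this
  have h2 : ∑ i, (t i - 1) + p = ∑ i, t i := by
    have h3 : ∑ i, (t i - 1 + 1) = ∑ i, t i :=
      Finset.sum_congr rfl fun i _ => Nat.sub_add_cancel (ht i)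
    rw [← h3, Finset.sum_add_distrib]
    simp
  omega

lemma iso_cmg [Finite V] (G : SimpleGraph V) (h : G.IsCompleteMultipartite) {u v : V}
    (huv : G.Adj u v) : ∃ (p : ℕ) (t : Fin p → ℕ), 2 ≤ p ∧ (∀ i, 1 ≤ t i) ∧
      Nonempty (G ≃g SimpleGraph.completeMultipartiteGraph fun i => Fin (t i)) := by
  classical
  have := Fintype.ofFinite V
  have : Finite (Quotient h.setoid) := Quotient.finite _
  obtain ⟨p, ⟨e⟩⟩ := Finite.exists_equiv_fin (Quotient h.setoid)
  let c : V → Fin p := fun x => e (Quotient.mk h.setoid x)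
  have hG : ∀ x y, G.Adj x y ↔ c x ≠ c y := by
    intro x y
    have : c x = c y ↔ ¬ G.Adj x y := by
      simp only [c, e.apply_eq_iff_eq]
      exact Quotient.eq (r := h.setoid)
    rw [ne_eq, this, not_not]
  have hc : Function.Surjective c := e.surjective.comp Quotient.mk_surjective
  let t : Fin p → ℕ := fun i => Fintype.card {x // c x = i}
  refine ⟨p, t, ?_, ?_, ⟨⟨(Equiv.sigmaFiberEquiv c).symm.trans
    (Equiv.sigmaCongrRight fun i => Fintype.equivFin _), ?_⟩⟩⟩
  · have h1 := (hG u v).1 huv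
    have : Nontrivial (Fin p) := ⟨_, _, h1⟩
    exact Fin.nontrivial_iff_two_le.1 this
  · intro i
    obtain ⟨x, hx⟩ := hc i
    exact Fintype.card_pos_iff.2 ⟨⟨x, hx⟩⟩
  · intro x y
    rw [hG]
    rfl

/-- A vertex set without outgoing edges splits the graph. -/
noncomputable def splitIso (G : SimpleGraph V) (C : Set V)
    (h : ∀ x ∈ C, ∀ y ∉ C, ¬ G.Adj x y) : G ≃g (G.induce C ⊕g G.induce Cᶜ) := by
  classical
  refine RelIso.symm ⟨Equiv.Set.sumCompl C, ?_⟩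
  rintro (⟨x, hx⟩ | ⟨x, hx⟩) (⟨y, hy⟩ | ⟨y, hy⟩)
  · simp
  · simpa using h x hx y hy
  · simpa using fun h' => h y hy x hx (SimpleGraph.Adj.symm h')
  · simp

theorem disconnected_characterization {n s : ℕ} (hn : 6 ≤ n) (hs : 2 ≤ s) (hsn : s ≤ n - 3)
    (G : SimpleGraph (Fin n)) (hdisc : ¬ G.Connected) :
    memClass s G ↔
      ((∃ H : SimpleGraph (Fin (n - 1)), memClass (s - 1) H ∧
          Nonempty (G ≃g (H ⊕g (⊥ : SimpleGraph (Fin 1))))) ∨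
        (∃ (p q : ℕ) (t : Fin p → ℕ) (r : Fin q → ℕ),
          2 ≤ p ∧ 2 ≤ q ∧ (∀ i, 1 ≤ t i) ∧ (∀ j, 1 ≤ r j) ∧
          ((∑ i, (t i - 1)) + (∑ j, (r j - 1)) = s) ∧
          ((∑ i, t i) + (∑ j, r j) = n) ∧
          Nonempty (G ≃g ((SimpleGraph.completeMultipartiteGraph fun i => Fin (t i)) ⊕g
            (SimpleGraph.completeMultipartiteGraph fun j => Fin (r j)))))) := by
  classical
  constructor
  · rintro ⟨hpos, hnull⟩
    by_cases hiso : ∀ v, ∃ w, G.Adj v w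
    · right
      have hpre : ¬ G.Preconnected := fun hp =>
        hdisc ((SimpleGraph.connected_iff G).2 ⟨hp, ⟨⟨0, by omega⟩⟩⟩)
      unfold SimpleGraph.Preconnected at hpre
      push Not at hpre
      obtain ⟨a, b, hab⟩ := hpre
      let C : Set (Fin n) := {x | G.Reachable a x}
      have hC : ∀ x ∈ C, ∀ y ∉ C, ¬ G.Adj x y := fun x hx y hy h =>
        hy (SimpleGraph.Reachable.trans hx h.reachable)
      have e := splitIso G C hC
      have h1 : ∀ v : C, ∃ w, (G.induce C).Adj v w := by
        rintro ⟨v, hv⟩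
        obtain ⟨w, hw⟩ := hiso v
        exact ⟨⟨w, by_contra fun h => hC v hv w h hw⟩, hw⟩
      have h2 : ∀ v : (Cᶜ : Set (Fin n)), ∃ w, (G.induce Cᶜ).Adj v w := by
        rintro ⟨v, hv⟩
        obtain ⟨w, hw⟩ := hiso v
        exact ⟨⟨w, fun h => hC w h v hv hw.symm⟩, hw⟩
      obtain ⟨a', ha'⟩ := h1 ⟨a, SimpleGraph.Reachable.refl a⟩
      obtain ⟨b', hb'⟩ := h2 ⟨b, hab⟩
      have p1 := posCount_pos _ ha'
      have p2 := posCount_pos _ hb'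
      rw [posCount_iso e, posCount_sum] at hpos
      obtain ⟨p, t, hp, ht, ⟨e1⟩⟩ := iso_cmg _ (isCompleteMultipartite_of _ (by omega) h1) ha'
      obtain ⟨q, r, hq, hr, ⟨e2⟩⟩ := iso_cmg _ (isCompleteMultipartite_of _ (by omega) h2) hb'
      have e3 := e.trans (SimpleGraph.Iso.sumCongr e1 e2)
      refine ⟨p, q, t, r, hp, hq, ht, hr, ?_, ?_, ⟨e3⟩⟩
      · rw [← (counts_cmg t hp ht).2, ← (counts_cmg r hq hr).2, ← nullCount_sum,
          ← nullCount_iso e3, hnull]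
      · have := Fintype.card_congr e3.toEquiv
        simpa using this.symm
    · left
      push Not at hiso
      obtain ⟨v, hv⟩ := hiso
      have e := splitIso G {v}ᶜ (by
        intro x _ y hy h
        have : y = v := by simpa using hy
        subst this
        exact hv x h.symm)
      have hcard : Fintype.card ({v}ᶜ : Set (Fin n)) = n - 1 := by
        rw [Fintype.card_compl_set]; simp
      have hcard1 : Fintype.card (({v}ᶜ)ᶜ : Set (Fin n)) = 1 := by
        simp
      let e1 := (G.induce ({v}ᶜ : Set (Fin n))).overFinIso hcard
      let f : (({v}ᶜ)ᶜ : Set (Fin n)) ≃ Fin 1 := Fintype.equivFinOfCardEq hcard1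
      let e2 : G.induce (({v}ᶜ)ᶜ : Set (Fin n)) ≃g (⊥ : SimpleGraph (Fin 1)) :=
        ⟨f, by
          intro x y
          have : x = y := f.injective (Subsingleton.elim _ _)
          subst this
          simp⟩
      have e3 := e.trans (SimpleGraph.Iso.sumCongr e1 e2)
      refine ⟨_, ?_, ⟨e3⟩⟩
      rw [posCount_iso e3, posCount_sum, posCount_bot_one] at hpos
      rw [nullCount_iso e3, nullCount_sum, nullCount_bot_one] at hnull
      exact ⟨by omega, by omega⟩
  · rintro (⟨H, ⟨hp, hz⟩, ⟨e⟩⟩ | ⟨p, q, t, r, hp, hq, ht, hr, hsum, -, ⟨e⟩⟩)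
    · refine ⟨?_, ?_⟩
      · rw [posCount_iso e, posCount_sum, posCount_bot_one, hp]
      · rw [nullCount_iso e, nullCount_sum, nullCount_bot_one, hz]; omega
    · refine ⟨?_, ?_⟩
      · rw [posCount_iso e, posCount_sum, (counts_cmg t hp ht).1, (counts_cmg r hq hr).1]
      · rw [nullCount_iso e, nullCount_sum, (counts_cmg t hp ht).2, (counts_cmg r hq hr).2, hsum]

end TwoPosEig
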